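/- There exists exactly one sequence (Γ_i)_{i ≥ 0} of complex n×n matrices such that Γ₀ is the identity matrix, the determinant of the matrix power series ∑_{i ≥ 0} Γ_i u^i (an n×n matrix over ℂ[[u]]) equals 1, and (Γ_i) solves the A_{n−1} reduced string equation. Moreover, this unique solution satisfies (Γ_k)_{a,b} = 0 whenever n+1 does not divide a − b + k. -/

import Mathlib

/-- The subdiagonal shift matrix `A` of size `n`: `(A)_{a,b} = 1` iff `a = b + 1`. -/
noncomputable def matA (n : ℕ) : Matrix (Fin n) (Fin n) ℂ :=
  Matrix.of fun a b => if (a : ℕ) = (b : ℕ) + 1 then 1 else 0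

/-- The matrix `B` of size `n` whose only nonzero entry is a `1` in the upper-right
corner (position `(1,n)`, zero-indexed `(0, n−1)`). -/
noncomputable def matB (n : ℕ) : Matrix (Fin n) (Fin n) ℂ :=
  Matrix.of fun a b => if (a : ℕ) = 0 ∧ (b : ℕ) = n - 1 then 1 else 0

/-- The diagonal matrix `ρ = diag(−(n−1)/2, −(n−3)/2, …, (n−1)/2)`, i.e. (one-indexed)
`ρ_{a,a} = a − (n+1)/2`. -/
noncomputable def matRho (n : ℕ) : Matrix (Fin n) (Fin n) ℂ :=
  Matrix.diagonal fun a => ((a : ℕ) : ℂ) - ((n : ℂ) - 1) / 2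

/-- A sequence `(Γ_i)_{i ≥ 0}` of complex `n×n` matrices (with `Γ_{−1} = 0`) solves the
`A_{n−1}` reduced string equation if for all `i ≥ 0`:
`A·Γ_i + B·Γ_{i+1} + (i−1)·Γ_{i−1} − (1/n)·ρ·Γ_{i−1} = Γ_i·A + Γ_{i+1}·B`. -/
def SolvesAredSE (n : ℕ) (Γ : ℕ → Matrix (Fin n) (Fin n) ℂ) : Prop :=
  ∀ i : ℕ,
    matA n * Γ i + matB n * Γ (i + 1)
      + ((i : ℂ) - 1) • (if i = 0 then 0 else Γ (i - 1))
      - ((n : ℂ))⁻¹ • (matRho n * (if i = 0 then 0 else Γ (i - 1)))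
    = Γ i * matA n + Γ (i + 1) * matB n

/-- The condition that the determinant of `∑_{i ≥ 0} Γ_i u^i`, viewed as an `n×n` matrix
over `ℂ[[u]]`, is `1`. -/
def DetOne (n : ℕ) (Γ : ℕ → Matrix (Fin n) (Fin n) ℂ) : Prop :=
  (Matrix.of fun a b => PowerSeries.mk fun i => Γ i a b :
      Matrix (Fin n) (Fin n) (PowerSeries ℂ)).det = 1


/-- diagonal weight -/
noncomputable def wt (N m a : ℕ) : ℂ :=
  (((a + m) / (N + 1) : ℕ) : ℂ) - (((N + 1 : ℕ) : ℂ))⁻¹ * ((a : ℂ) - (((N + 1 : ℕ) : ℂ) - 1) / 2)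

/-- right side of the graded recursion -/
noncomputable def rhsF (N : ℕ) (f : ℕ → ℕ → ℂ) (k a : ℕ) : ℂ :=
  if k < N + 2 then 0 else wt N (k - (N + 2)) a * f (k - (N + 2)) a

/-- graded form of the reduced string equation -/
def IsSolF (N : ℕ) (f : ℕ → ℕ → ℂ) : Prop :=
  ∀ k, 1 ≤ k → (∀ a, a < N → f k a + rhsF N f k (a + 1) = f k (a + 1)) ∧
    f k N + rhsF N f k 0 = f k 0

lemma sum_floor (N m : ℕ) : ∑ a ∈ Finset.range (N + 1), (a + m) / (N + 1) = m := by
  induction m with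
  | zero =>
    apply Finset.sum_eq_zero
    intro a ha
    exact Nat.div_eq_of_lt (by simpa using ha)
  | succ m ih =>
    have h1 := Finset.sum_range_succ (fun a => (a + m) / (N + 1)) (N + 1)
    have h2 := Finset.sum_range_succ' (fun a => (a + m) / (N + 1)) (N + 1)
    rw [h1, ih] at h2
    have h3 : (N + 1 + m) / (N + 1) = m / (N + 1) + 1 := by
      rw [Nat.add_div_left _ (Nat.succ_pos N)]
    simp only [h3, zero_add] at h2
    have h4 : ∀ a, a + (m + 1) = a + 1 + m := fun a => by ring
    simp only [h4]
    omega

lemma sum_rho (N : ℕ) : ∑ a ∈ Finset.range (N + 1),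
    ((a : ℂ) - (((N + 1 : ℕ) : ℂ) - 1) / 2) = 0 := by
  have h : ∀ c : ℂ, ∀ k : ℕ, ∑ a ∈ Finset.range k, ((a : ℂ) - c) = k * (k - 1) / 2 - k * c := by
    intro c k
    induction k with
    | zero => simp
    | succ k ih => rw [Finset.sum_range_succ, ih]; push_cast; ring
  rw [h]; push_cast; ring

lemma sum_wt (N m : ℕ) : ∑ a ∈ Finset.range (N + 1), wt N m a = m := by
  unfold wt
  rw [Finset.sum_sub_distrib, ← Finset.mul_sum, sum_rho, ← Nat.cast_sum, sum_floor]
  simp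

lemma IsSolF.sum_eq {N : ℕ} {f : ℕ → ℕ → ℂ} (h : IsSolF N f) (m : ℕ) :
    ∑ a ∈ Finset.range (N + 1), wt N m a * f m a = 0 := by
  obtain ⟨h1, h2⟩ := h (m + (N + 2)) (by omega)
  have e : ∀ a, rhsF N f (m + (N + 2)) a = wt N m a * f m a := by
    intro a; simp [rhsF]
  simp only [e] at h1 h2
  rw [Finset.sum_range_succ']
  have : ∀ a ∈ Finset.range N, wt N m (a + 1) * f m (a + 1) =
      f (m + (N + 2)) (a + 1) - f (m + (N + 2)) a := by
    intro a ha
    have := h1 a (by simpa using ha)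
    linear_combination this
  rw [Finset.sum_congr rfl this, Finset.sum_range_sub]
  linear_combination h2

lemma IsSolF.step {N : ℕ} {f : ℕ → ℕ → ℂ} (h : IsSolF N f) (k : ℕ) (hk : 1 ≤ k)
    (h0 : N + 2 ≤ k → ∀ a, a ≤ N → f (k - (N + 2)) a = 0) : ∀ a, a ≤ N → f k a = 0 := by
  obtain ⟨h1, h2⟩ := h k hk
  have e : ∀ a, a ≤ N → rhsF N f k a = 0 := by
    intro a ha
    unfold rhsF
    split_ifs with hh
    · rfl
    · rw [h0 (by omega) a ha, mul_zero]
  have c : ∀ a, a ≤ N → f k a = f k 0 := by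
    intro a
    induction a with
    | zero => intro _; rfl
    | succ a ih =>
      intro ha
      rw [← h1 a (by omega), e _ ha, ih (by omega), add_zero]
  have s := h.sum_eq k
  have : ∑ a ∈ Finset.range (N + 1), wt N k a * f k a =
      ∑ a ∈ Finset.range (N + 1), wt N k a * f k 0 := by
    apply Finset.sum_congr rfl
    intro a ha
    rw [c a (by simp at ha; omega)]
  rw [this, ← Finset.sum_mul, sum_wt] at s
  have hk' : (k : ℂ) ≠ 0 := by exact_mod_cast (by omega : k ≠ 0)
  have z : f k 0 = 0 := by simpa [hk'] using s
  intro a ha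
  rw [c a ha, z]

lemma IsSolF.sub {N : ℕ} {f g : ℕ → ℕ → ℂ} (hf : IsSolF N f) (hg : IsSolF N g) :
    IsSolF N (fun k a => f k a - g k a) := by
  have e : ∀ k a, rhsF N (fun k a => f k a - g k a) k a = rhsF N f k a - rhsF N g k a := by
    intro k a; unfold rhsF; split_ifs <;> ring
  intro k hk
  obtain ⟨h1, h2⟩ := hf k hk
  obtain ⟨h3, h4⟩ := hg k hk
  refine ⟨fun a ha => ?_, ?_⟩
  · rw [e]; linear_combination h1 a ha - h3 a ha
  · rw [e]; linear_combination h2 - h4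

lemma IsSolF.grading {N : ℕ} {f : ℕ → ℕ → ℂ} (h : IsSolF N f) (k : ℕ) :
    ¬ (N + 2 ∣ k) → ∀ a, a ≤ N → f k a = 0 := by
  induction k using Nat.strong_induction_on with
  | _ k ih =>
    intro hd
    have hk : k ≠ 0 := by rintro rfl; simp at hd
    apply h.step k (by omega)
    intro hk2
    apply ih _ (by omega)
    intro h3
    apply hd
    have := Nat.dvd_add h3 (dvd_refl (N + 2))
    rwa [Nat.sub_add_cancel hk2] at this

lemma IsSolF.zero {N : ℕ} {f : ℕ → ℕ → ℂ} (h : IsSolF N f) (h0 : ∀ a, a ≤ N → f 0 a = 0)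
    (k : ℕ) : ∀ a, a ≤ N → f k a = 0 := by
  induction k using Nat.strong_induction_on with
  | _ k ih =>
    rcases Nat.eq_zero_or_pos k with rfl | hk
    · exact h0
    · exact h.step k hk fun _ => ih _ (by omega)

/-- the constructed solution -/
noncomputable def solF (N : ℕ) (k : ℕ) : ℕ → ℂ :=
  if k = 0 then fun _ => 1
  else if k < N + 2 then fun _ => 0
  else
    let prev := solF N (k - (N + 2))
    let s : ℕ → ℂ := fun a => ∑ j ∈ Finset.range (a + 1), wt N (k - (N + 2)) j * prev j
    fun a => s a - (k : ℂ)⁻¹ * ∑ j ∈ Finset.range (N + 1), wt N k j * s j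
termination_by k
decreasing_by omega

lemma solF_zero (N a : ℕ) : solF N 0 a = 1 := by rw [solF]; simp

lemma solF_small (N k a : ℕ) (h : k ≠ 0) (h2 : k < N + 2) : solF N k a = 0 := by
  rw [solF]; simp [h, h2]

lemma solF_big (N k a : ℕ) (h : N + 2 ≤ k) : solF N k a =
    (∑ j ∈ Finset.range (a + 1), wt N (k - (N + 2)) j * solF N (k - (N + 2)) j)
      - (k : ℂ)⁻¹ * ∑ i ∈ Finset.range (N + 1), wt N k i *
        ∑ j ∈ Finset.range (i + 1), wt N (k - (N + 2)) j * solF N (k - (N + 2)) j := by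
  rw [solF]
  rw [if_neg (by omega), if_neg (by omega)]

lemma solF_sum (N m : ℕ) : ∑ a ∈ Finset.range (N + 1), wt N m a * solF N m a = 0 := by
  by_cases h0 : m = 0
  · subst h0
    simp only [solF_zero, mul_one, sum_wt]; simp
  by_cases h1 : m < N + 2
  · simp [solF_small N m _ h0 h1]
  have hk' : (m : ℂ) ≠ 0 := by exact_mod_cast h0
  simp only [solF_big N m _ (by omega), mul_sub]
  rw [Finset.sum_sub_distrib, ← Finset.sum_mul, sum_wt, ← mul_assoc, mul_inv_cancel₀ hk']
  ring

lemma solF_isSol (N : ℕ) : IsSolF N (solF N) := by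
  intro k hk
  by_cases h : k < N + 2
  · simp [rhsF, h, solF_small N k _ (by omega) h]
  · simp only [rhsF, if_neg h]
    have hb := fun a => solF_big N k a (by omega)
    refine ⟨fun a ha => ?_, ?_⟩
    · rw [hb a, hb (a + 1), Finset.sum_range_succ _ (a + 1)]
      ring
    · rw [hb N, hb 0, solF_sum]
      simp only [zero_add, Finset.sum_range_one]
      ring

/-- The infinite-matrix form. -/
noncomputable def bigM (N : ℕ) (Γ : ℕ → Matrix (Fin (N + 1)) (Fin (N + 1)) ℂ) (p q : ℕ) : ℂ :=
  Γ (q / (N + 1)) (Fin.ofNat (N + 1) p) (Fin.ofNat (N + 1) q)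

lemma bigM_eq (N : ℕ) (Γ : ℕ → Matrix (Fin (N + 1)) (Fin (N + 1)) ℂ) (i : ℕ)
    (a b : Fin (N + 1)) : Γ i a b = bigM N Γ a ((N + 1) * i + b) := by
  have h1 : ((N + 1) * i + (b : ℕ)) / (N + 1) = i := by
    rw [Nat.mul_add_div (Nat.succ_pos N), Nat.div_eq_of_lt b.2, add_zero]
  have h2 : Fin.ofNat (N + 1) (a : ℕ) = a := by
    apply Fin.ext; simp
  have h3 : Fin.ofNat (N + 1) ((N + 1) * i + (b : ℕ)) = b := by
    apply Fin.ext
    simp only [Fin.val_ofNat, Nat.mul_add_mod]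
    exact Nat.mod_eq_of_lt b.2
  unfold bigM
  rw [h1, h2, h3]

/-- the lower order term -/
noncomputable def lowS (N : ℕ) (M : ℕ → ℕ → ℂ) (a q : ℕ) : ℂ :=
  if q < N + 1 then 0 else
  ((((q - (N + 1)) / (N + 1) : ℕ) : ℂ) -
    (((N + 1 : ℕ) : ℂ))⁻¹ * ((a : ℂ) - (((N + 1 : ℕ) : ℂ) - 1) / 2)) * M a (q - (N + 1))

lemma mulA_left (N : ℕ) (X : Matrix (Fin (N + 1)) (Fin (N + 1)) ℂ) (a : Fin N)
    (b : Fin (N + 1)) : (matA (N + 1) * X) a.succ b = X a.castSucc b := by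
  rw [Matrix.mul_apply, Finset.sum_eq_single a.castSucc]
  · simp [matA]
  · intro c _ hc
    have : ¬ ((a : ℕ) = (c : ℕ)) := fun h => hc (Fin.ext (by simp [h]))
    simp [matA, this]
  · simp

lemma mulA_left0 (N : ℕ) (X : Matrix (Fin (N + 1)) (Fin (N + 1)) ℂ)
    (b : Fin (N + 1)) : (matA (N + 1) * X) 0 b = 0 := by
  rw [Matrix.mul_apply]
  apply Finset.sum_eq_zero
  intro c _
  simp [matA]

lemma mulB_left (N : ℕ) (X : Matrix (Fin (N + 1)) (Fin (N + 1)) ℂ) (a : Fin N)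
    (b : Fin (N + 1)) : (matB (N + 1) * X) a.succ b = 0 := by
  rw [Matrix.mul_apply]
  apply Finset.sum_eq_zero
  intro c _
  simp [matB]

lemma mulB_left0 (N : ℕ) (X : Matrix (Fin (N + 1)) (Fin (N + 1)) ℂ)
    (b : Fin (N + 1)) : (matB (N + 1) * X) 0 b = X (Fin.last N) b := by
  rw [Matrix.mul_apply, Finset.sum_eq_single (Fin.last N)]
  · simp [matB]
  · intro c _ hc
    have : ¬ ((c : ℕ) = N) := fun h => hc (Fin.ext (by simp [h]))
    simp [matB, this]
  · simp

lemma mulA_right (N : ℕ) (X : Matrix (Fin (N + 1)) (Fin (N + 1)) ℂ) (a : Fin (N + 1))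
    (b : Fin N) : (X * matA (N + 1)) a b.castSucc = X a b.succ := by
  rw [Matrix.mul_apply, Finset.sum_eq_single b.succ]
  · simp [matA]
  · intro c _ hc
    have : ¬ ((c : ℕ) = (b : ℕ) + 1) := fun h => hc (Fin.ext (by simp [h]))
    simp [matA, this]
  · simp

lemma mulA_rightL (N : ℕ) (X : Matrix (Fin (N + 1)) (Fin (N + 1)) ℂ)
    (a : Fin (N + 1)) : (X * matA (N + 1)) a (Fin.last N) = 0 := by
  rw [Matrix.mul_apply]
  apply Finset.sum_eq_zero
  intro c _
  have : ¬ ((c : ℕ) = N + 1) := by omega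
  simp [matA, this]

lemma mulB_right (N : ℕ) (X : Matrix (Fin (N + 1)) (Fin (N + 1)) ℂ) (a : Fin (N + 1))
    (b : Fin N) : (X * matB (N + 1)) a b.castSucc = 0 := by
  rw [Matrix.mul_apply]
  apply Finset.sum_eq_zero
  intro c _
  have : ¬ ((b : ℕ) = N) := by omega
  simp [matB, this]

lemma mulB_rightL (N : ℕ) (X : Matrix (Fin (N + 1)) (Fin (N + 1)) ℂ)
    (a : Fin (N + 1)) : (X * matB (N + 1)) a (Fin.last N) = X a 0 := by
  rw [Matrix.mul_apply, Finset.sum_eq_single 0]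
  · simp [matB]
  · intro c _ hc
    simp [matB, hc]
  · simp

/-- entrywise right side -/
lemma right_entry (N : ℕ) (Γ : ℕ → Matrix (Fin (N + 1)) (Fin (N + 1)) ℂ) (i : ℕ)
    (a b : Fin (N + 1)) :
    (Γ i * matA (N + 1) + Γ (i + 1) * matB (N + 1)) a b
      = bigM N Γ a ((N + 1) * i + b + 1) := by
  rw [Matrix.add_apply]
  refine Fin.lastCases ?_ (fun b => ?_) b
  · rw [mulA_rightL, mulB_rightL, bigM_eq N Γ]
    simp [mul_add, add_assoc]
  · rw [mulA_right, mulB_right, bigM_eq N Γ]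
    simp [add_assoc]

lemma left_entry (N : ℕ) (Γ : ℕ → Matrix (Fin (N + 1)) (Fin (N + 1)) ℂ) (i : ℕ)
    (a : Fin N) (b : Fin (N + 1)) :
    (matA (N + 1) * Γ i + matB (N + 1) * Γ (i + 1)) a.succ b
      = bigM N Γ a ((N + 1) * i + b) := by
  rw [Matrix.add_apply, mulA_left, mulB_left, bigM_eq N Γ]
  simp

lemma left_entry0 (N : ℕ) (Γ : ℕ → Matrix (Fin (N + 1)) (Fin (N + 1)) ℂ) (i : ℕ)
    (b : Fin (N + 1)) :
    (matA (N + 1) * Γ i + matB (N + 1) * Γ (i + 1)) 0 b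
      = bigM N Γ N ((N + 1) * i + b + (N + 1)) := by
  rw [Matrix.add_apply, mulA_left0, mulB_left0, bigM_eq N Γ]
  simp only [Fin.val_last, zero_add]
  congr 1; ring

lemma low_entry (N : ℕ) (Γ : ℕ → Matrix (Fin (N + 1)) (Fin (N + 1)) ℂ) (i : ℕ)
    (a b : Fin (N + 1)) :
    (((i : ℂ) - 1) • (if i = 0 then 0 else Γ (i - 1))
      - (((N + 1 : ℕ) : ℂ))⁻¹ • (matRho (N + 1) * (if i = 0 then 0 else Γ (i - 1)))) a b
      = lowS N (bigM N Γ) a ((N + 1) * i + b) := by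
  rcases i with _ | i
  · have : (b : ℕ) < N + 1 := b.2
    simp [lowS]
    intro h; omega
  · have e : (N + 1) * (i + 1) + (b : ℕ) - (N + 1) = (N + 1) * i + b := by
      rw [mul_add]; omega
    have e2 : ¬ ((N + 1) * (i + 1) + (b : ℕ) < N + 1) := by
      rw [mul_add]; omega
    have e3 : ((N + 1) * i + (b : ℕ)) / (N + 1) = i := by
      rw [Nat.mul_add_div (Nat.succ_pos N), Nat.div_eq_of_lt b.2, add_zero]
    unfold lowS
    rw [if_neg e2, e, e3, ← bigM_eq N Γ]
    simp [matRho, Matrix.sub_apply, Matrix.smul_apply, Matrix.diagonal_mul]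
    ring

lemma solves_iff (N : ℕ) (Γ : ℕ → Matrix (Fin (N + 1)) (Fin (N + 1)) ℂ) :
    SolvesAredSE (N + 1) Γ ↔ ∀ q,
      (∀ a, a < N → bigM N Γ a q + lowS N (bigM N Γ) (a + 1) q = bigM N Γ (a + 1) (q + 1)) ∧
      bigM N Γ N (q + (N + 1)) + lowS N (bigM N Γ) 0 q = bigM N Γ 0 (q + 1) := by
  constructor
  · intro h q
    have h1 := h (q / (N + 1))
    rw [add_sub_assoc] at h1
    have hq : (N + 1) * (q / (N + 1)) + ((Fin.ofNat (N + 1) q : Fin (N + 1)) : ℕ) = q := by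
      simpa using Nat.div_add_mod q (N + 1)
    refine ⟨fun a ha => ?_, ?_⟩
    · have h2 := congrFun (congrFun h1 (Fin.succ ⟨a, ha⟩)) (Fin.ofNat (N + 1) q)
      rw [Matrix.add_apply, left_entry, low_entry, right_entry, hq] at h2
      simpa using h2
    · have h2 := congrFun (congrFun h1 0) (Fin.ofNat (N + 1) q)
      rw [Matrix.add_apply, left_entry0, low_entry, right_entry, hq] at h2
      simpa using h2
  · intro h i
    rw [add_sub_assoc]
    ext a b
    obtain ⟨h1, h2⟩ := h ((N + 1) * i + b)
    rw [Matrix.add_apply, low_entry, right_entry]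
    refine Fin.cases ?_ (fun a => ?_) a
    · rw [left_entry0]; simpa using h2
    · rw [left_entry]; simpa using h1 a a.2

lemma bigM_low {N : ℕ} {Γ : ℕ → Matrix (Fin (N + 1)) (Fin (N + 1)) ℂ} (h0 : Γ 0 = 1)
    {p q : ℕ} (hp : p ≤ N) (hq : q ≤ N) : bigM N Γ p q = if p = q then 1 else 0 := by
  unfold bigM
  rw [Nat.div_eq_of_lt (by omega), h0, Matrix.one_apply]
  simp [Fin.ext_iff, Nat.mod_eq_of_lt (Nat.lt_succ_of_le hp), Nat.mod_eq_of_lt (Nat.lt_succ_of_le hq)]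

/-- graded components of a solution -/
noncomputable def toF (N : ℕ) (Γ : ℕ → Matrix (Fin (N + 1)) (Fin (N + 1)) ℂ) (k a : ℕ) : ℂ :=
  bigM N Γ a (a + k)

lemma toF_zero {N : ℕ} {Γ : ℕ → Matrix (Fin (N + 1)) (Fin (N + 1)) ℂ} (h0 : Γ 0 = 1)
    (a : ℕ) (ha : a ≤ N) : toF N Γ 0 a = 1 := by
  unfold toF
  rw [bigM_low h0 ha (by omega)]; simp

lemma toF_isSol {N : ℕ} {Γ : ℕ → Matrix (Fin (N + 1)) (Fin (N + 1)) ℂ} (h0 : Γ 0 = 1)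
    (h : SolvesAredSE (N + 1) Γ) : IsSolF N (toF N Γ) := by
  rw [solves_iff] at h
  have key : ∀ k a q, a ≤ N → q + 1 = a + k → lowS N (bigM N Γ) a q = rhsF N (toF N Γ) k a := by
    intro k a q ha hq
    unfold lowS rhsF
    by_cases h1 : q < N + 1
    · rw [if_pos h1]
      split_ifs with h2
      · rfl
      · omega
    · rw [if_neg h1]
      split_ifs with h2
      · rw [bigM_low h0 ha (by omega), if_neg (by omega), mul_zero]
      · unfold wt toF
        have : q - (N + 1) = a + (k - (N + 2)) := by omega
        rw [this]
  intro k hk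
  refine ⟨fun a ha => ?_, ?_⟩
  · have := (h (a + k)).1 a ha
    rw [key k (a + 1) (a + k) (by omega) (by omega)] at this
    unfold toF at this ⊢
    rw [this]; congr 1; omega
  · have := (h (k - 1)).2
    rw [key k 0 (k - 1) (by omega) (by omega)] at this
    unfold toF at this ⊢
    rw [show k - 1 + (N + 1) = N + k by omega, show k - 1 + 1 = 0 + k by omega] at this
    exact this

lemma entry_toF {N : ℕ} {Γ : ℕ → Matrix (Fin (N + 1)) (Fin (N + 1)) ℂ} (h0 : Γ 0 = 1)
    (i : ℕ) (a b : Fin (N + 1)) : Γ i a b =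
      if (a : ℕ) ≤ (N + 1) * i + b then toF N Γ ((N + 1) * i + b - a) a else 0 := by
  rw [bigM_eq N Γ]
  split_ifs with h
  · unfold toF
    congr 1; omega
  · rw [bigM_low h0 (by omega) (by omega), if_neg (by omega)]

/-- the solution -/
noncomputable def solG (N : ℕ) (i : ℕ) : Matrix (Fin (N + 1)) (Fin (N + 1)) ℂ :=
  Matrix.of fun a b =>
    if (a : ℕ) ≤ (N + 1) * i + b then solF N ((N + 1) * i + b - a) a else 0

lemma solG_bigM (N p q : ℕ) (hp : p ≤ N) :
    bigM N (solG N) p q = if p ≤ q then solF N (q - p) p else 0 := by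
  simp [bigM, solG, Nat.mod_eq_of_lt (Nat.lt_succ_of_le hp), Nat.div_add_mod]

lemma solG_zero (N : ℕ) : solG N 0 = 1 := by
  ext a b
  simp only [solG, Matrix.of_apply, Matrix.one_apply, mul_zero, zero_add, Fin.ext_iff]
  split_ifs with h1 h2 h2
  · rw [h2, Nat.sub_self, solF_zero]
  · rw [solF_small _ _ _ (by omega) (by omega)]
  · omega
  · rfl

lemma solG_solves (N : ℕ) : SolvesAredSE (N + 1) (solG N) := by
  rw [solves_iff]
  have hs := solF_isSol N
  have key : ∀ k a q, a ≤ N → q + 1 = a + k →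
      lowS N (bigM N (solG N)) a q = rhsF N (solF N) k a := by
    intro k a q ha hq
    unfold lowS rhsF
    by_cases h1 : q < N + 1
    · rw [if_pos h1]
      split_ifs with h2
      · rfl
      · omega
    · rw [if_neg h1, solG_bigM _ _ _ ha]
      split_ifs with h2 h3 h3
      · omega
      · unfold wt
        have : q - (N + 1) = a + (k - (N + 2)) := by omega
        rw [this, Nat.add_sub_cancel_left]
      · rw [mul_zero]
      · omega
  intro q
  refine ⟨fun a ha => ?_, ?_⟩
  · rw [solG_bigM _ _ _ (by omega), solG_bigM _ _ _ (by omega)]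
    by_cases h : a < q
    · have := (hs (q - a) (by omega)).1 a ha
      rw [key (q - a) (a + 1) q (by omega) (by omega), if_pos (by omega), if_pos (by omega),
        show q + 1 - (a + 1) = q - a by omega]
      exact this
    · have : lowS N (bigM N (solG N)) (a + 1) q = 0 := by
        unfold lowS; rw [if_pos (by omega)]
      rw [this]
      by_cases h2 : a = q
      · subst h2; simp [solF_zero]
      · rw [if_neg (by omega), if_neg (by omega), add_zero]
  · rw [solG_bigM _ _ _ (by omega), solG_bigM _ _ _ (by omega)]
    have := (hs (q + 1) (by omega)).2
    rw [key (q + 1) 0 q (by omega) (by omega), if_pos (by omega), if_pos (by omega),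
      show q + (N + 1) - N = q + 1 by omega]
    exact this

lemma deriv_prod {ι : Type*} [DecidableEq ι] {R : Type*} [CommRing R] {K : Type*}
    [CommRing K] [Algebra K R] (D : Derivation K R R)
    (s : Finset ι) (f : ι → R) :
    D (∏ j ∈ s, f j) = ∑ i ∈ s, ∏ j ∈ s, (if j = i then D (f j) else f j) := by
  induction s using Finset.induction_on with
  | empty => simp
  | insert a s ha ih =>
    rw [Finset.prod_insert ha, Derivation.leibniz, ih, Finset.sum_insert ha,
      Finset.prod_insert ha, if_pos rfl]
    have h1 : ∏ j ∈ s, (if j = a then D (f j) else f j) = ∏ j ∈ s, f j := by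
      apply Finset.prod_congr rfl
      intro j hj
      rw [if_neg (by rintro rfl; exact ha hj)]
    have h2 : ∀ i ∈ s, ∏ j ∈ insert a s, (if j = i then D (f j) else f j) =
        f a * ∏ j ∈ s, (if j = i then D (f j) else f j) := by
      intro i hi
      rw [Finset.prod_insert ha, if_neg (by rintro rfl; exact ha hi)]
    rw [h1, Finset.sum_congr rfl h2, ← Finset.mul_sum, smul_eq_mul, smul_eq_mul]
    ring

lemma deriv_det {m : ℕ} {R : Type*} [CommRing R] {K : Type*}
    [CommRing K] [Algebra K R] (D : Derivation K R R)
    (M : Matrix (Fin m) (Fin m) R) :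
    D M.det = (M.adjugate * M.map D).trace := by
  have h : (M.adjugate * M.map D).trace = ∑ i, (M.updateCol i (fun a => D (M a i))).det := by
    rw [Matrix.trace]
    apply Finset.sum_congr rfl
    intro i _
    rw [← Matrix.cramer_apply, Matrix.cramer_eq_adjugate_mulVec]
    rfl
  rw [h]
  simp only [Matrix.det_apply, map_sum]
  rw [Finset.sum_comm]
  apply Finset.sum_congr rfl
  intro σ _
  rw [← Finset.smul_sum, Units.smul_def, Units.smul_def, map_zsmul, deriv_prod]
  congr 1
  apply Finset.sum_congr rfl
  intro i _
  apply Finset.prod_congr rfl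
  intro j _
  rw [Matrix.updateCol_apply]
  split_ifs with h
  · rw [h]
  · rfl

open PowerSeries in
lemma detOne_of_solves (n : ℕ) (Γ : ℕ → Matrix (Fin n) (Fin n) ℂ) (h0 : Γ 0 = 1)
    (hρ : (matRho n).trace = 0) (h : SolvesAredSE n Γ) : DetOne n Γ := by
  unfold DetOne
  set G : Matrix (Fin n) (Fin n) (PowerSeries ℂ) :=
    Matrix.of fun a b => PowerSeries.mk fun i => Γ i a b with hG
  let D : Derivation ℂ (PowerSeries ℂ) (PowerSeries ℂ) :=
    PowerSeries.derivative ℂ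
  have hD : ∀ f : PowerSeries ℂ, D f = PowerSeries.derivative ℂ f := fun _ => rfl
  let cA : Matrix (Fin n) (Fin n) (PowerSeries ℂ) := (matA n).map (C : ℂ →+* PowerSeries ℂ)
  let cB : Matrix (Fin n) (Fin n) (PowerSeries ℂ) := (matB n).map (C : ℂ →+* PowerSeries ℂ)
  let cR : Matrix (Fin n) (Fin n) (PowerSeries ℂ) := (matRho n).map (C : ℂ →+* PowerSeries ℂ)
  let L := (X : PowerSeries ℂ) • cA + cB
  have hl : ∀ (Y : Matrix (Fin n) (Fin n) ℂ) (a b : Fin n) (k : ℕ),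
      coeff k ((Y.map (C : ℂ →+* PowerSeries ℂ) * G) a b) = (Y * Γ k) a b := by
    intro Y a b k
    simp [Matrix.mul_apply, hG]
  have hr : ∀ (Y : Matrix (Fin n) (Fin n) ℂ) (a b : Fin n) (k : ℕ),
      coeff k ((G * Y.map (C : ℂ →+* PowerSeries ℂ)) a b) = (Γ k * Y) a b := by
    intro Y a b k
    simp [Matrix.mul_apply, hG]
  have main : L * G + (X ^ 3 : PowerSeries ℂ) • G.map D
      - (X ^ 2 * C ((n : ℂ)⁻¹) : PowerSeries ℂ) • (cR * G) = G * L := by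
    have e1 : L * G = (X : PowerSeries ℂ) • (cA * G) + cB * G := by
      simp [L, add_mul]
    have e2 : G * L = (X : PowerSeries ℂ) • (G * cA) + G * cB := by
      simp [L, mul_add]
    rw [e1, e2]
    ext a b k
    simp only [Matrix.add_apply, Matrix.sub_apply, Matrix.smul_apply, smul_eq_mul, map_add,
      map_sub, Matrix.map_apply, cA, cB, cR, hl, hr, mul_assoc]
    rcases k with _ | k
    · simp [h0, pow_succ, mul_assoc]
    · have hk := congrFun (congrFun (h k) a) b
      simp only [Matrix.add_apply, Matrix.sub_apply, Matrix.smul_apply, smul_eq_mul] at hk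
      simp only [pow_succ, pow_zero, one_mul, mul_assoc, coeff_succ_X_mul, hl, hr]
      rcases k with _ | k
      · simp at hk ⊢
        linear_combination hk
      · simp only [coeff_succ_X_mul, coeff_C_mul, hl]
        have e3 : coeff k (X * D (G a b)) = (k : ℂ) * Γ k a b := by
          rcases k with _ | k
          · simp
          · rw [coeff_succ_X_mul, hD, coeff_derivative]
            simp [hG]; ring
        rw [e3]
        simp at hk
        linear_combination hk
  have t := congrArg (fun Z => (G.adjugate * Z).trace) main
  simp only [Matrix.mul_sub, Matrix.mul_add, Matrix.trace_sub, Matrix.trace_add,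
    Matrix.mul_smul, Matrix.trace_smul, smul_eq_mul] at t
  have t1 : (G.adjugate * (L * G)).trace = (G.adjugate * (G * L)).trace := by
    rw [← Matrix.mul_assoc, Matrix.trace_mul_comm, ← Matrix.mul_assoc, ← Matrix.mul_assoc,
      Matrix.mul_adjugate, Matrix.adjugate_mul]
  have t2 : (G.adjugate * (cR * G)).trace = 0 := by
    rw [Matrix.trace_mul_comm, Matrix.mul_assoc, Matrix.mul_adjugate, Matrix.mul_smul,
      Matrix.mul_one, Matrix.trace_smul]
    have : cR.trace = C (matRho n).trace := by simp [cR, Matrix.trace]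
    rw [this, hρ]; simp
  rw [t1, t2] at t
  have t3 : (X ^ 3 : PowerSeries ℂ) * D G.det = 0 := by rw [deriv_det D G]; linear_combination t
  have t4 : D G.det = 0 := by
    rcases mul_eq_zero.mp t3 with h | h
    · exact absurd h (pow_ne_zero _ X_ne_zero)
    · exact h
  apply PowerSeries.derivative.ext
  · rw [← hD, t4, derivative_one]
  · rw [RingHom.map_det, map_one]
    have : (constantCoeff (R := ℂ)).mapMatrix G = 1 := by
      ext a b
      simp [hG, h0, ← coeff_zero_eq_constantCoeff_apply]
    rw [this, Matrix.det_one]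

lemma trace_rho (N : ℕ) : (matRho (N + 1)).trace = 0 := by
  rw [matRho, Matrix.trace_diagonal,
    Fin.sum_univ_eq_sum_range (fun a => (a : ℂ) - (((N + 1 : ℕ) : ℂ) - 1) / 2) (N + 1)]
  exact sum_rho N

lemma sol_unique (N : ℕ) (Γ Γ' : ℕ → Matrix (Fin (N + 1)) (Fin (N + 1)) ℂ) (h0 : Γ 0 = 1)
    (h0' : Γ' 0 = 1) (h : SolvesAredSE (N + 1) Γ) (h' : SolvesAredSE (N + 1) Γ') : Γ = Γ' := by
  have hz := ((toF_isSol h0 h).sub (toF_isSol h0' h')).zero (by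
    intro a ha
    rw [toF_zero h0 a ha, toF_zero h0' a ha, sub_self])
  funext i
  ext a b
  rw [entry_toF h0, entry_toF h0', sub_eq_zero.mp (hz _ a (by omega))]

/-- there is exactly one sequence `(Γ_i)` of complex `n×n` matrices with
`Γ₀ = 1`, `det(∑ Γ_i u^i) = 1` in `ℂ[[u]]`, solving the `A_{n−1}` reduced string
equation; moreover this solution satisfies `(Γ_k)_{a,b} = 0` whenever
`n + 1 ∤ a − b + k`. -/
theorem stmt_7 (n : ℕ) (hn : 2 ≤ n) :
    (∃! Γ : ℕ → Matrix (Fin n) (Fin n) ℂ,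
      Γ 0 = 1 ∧ DetOne n Γ ∧ SolvesAredSE n Γ) ∧
    (∀ Γ : ℕ → Matrix (Fin n) (Fin n) ℂ,
      Γ 0 = 1 → DetOne n Γ → SolvesAredSE n Γ →
      ∀ (k : ℕ) (a b : Fin n),
        ¬ ((n : ℤ) + 1 ∣ ((a : ℕ) : ℤ) - ((b : ℕ) : ℤ) + (k : ℤ)) → Γ k a b = 0) := by
  obtain ⟨N, rfl⟩ : ∃ N, n = N + 1 := ⟨n - 1, by omega⟩
  refine ⟨⟨solG N, ⟨solG_zero N, detOne_of_solves _ _ (solG_zero N) (trace_rho N)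
    (solG_solves N), solG_solves N⟩, ?_⟩, ?_⟩
  · rintro Γ ⟨h0, _, h⟩
    exact sol_unique N _ _ h0 (solG_zero N) h (solG_solves N)
  · intro Γ h0 _ h k a b hd
    rw [entry_toF h0]
    split_ifs with hab
    · apply (toF_isSol h0 h).grading _ _ _ (by omega)
      rintro ⟨c, hc⟩
      apply hd
      refine ⟨(k : ℤ) - c, ?_⟩
      have hc' : (N + 1) * k + (b : ℕ) = (N + 2) * c + a := by omega
      have hz : ((N : ℤ) + 1) * k + (b : ℕ) = (N + 2) * c + (a : ℕ) := by exact_mod_cast hc'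
      push_cast
      linear_combination -hz
    · rfl
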